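/- Let N ≥ 2 and let G = (V, E) be the homogeneous tree T_N, i.e., an infinite connected graph with no cycles in which every vertex has degree N. Fix a root o ∈ V, let d denote the graph distance, D_n = {x ∈ V : d(o,x) = n}, and let E_n be the set of edges joining a vertex of D_n to a vertex of D_{n+1}. Let σ > 1 and ε > 0. Then there exist an integer n0 ≥ 2 and a real δ > 0 such that, defining edge weights μ_{xy} = (n+n0)^{(σ+1)/(σ−1)} (ln(n+n0))^{1/(σ−1)+ε} / (N−1)^n for each edge (x,y) ∈ E_n (n ≥ 0), the following hold: (i) there are constants c, C > 0 with c · n^{2σ/(σ−1)}(ln n)^{1/(σ−1)+ε} ≤ μ(B(o,n)) ≤ C · n^{2σ/(σ−1)}(ln n)^{1/(σ−1)+ε} for all n ≥ 2; and (ii) the function u defined by u(x) = δ / ((n+n0)^{2/(σ−1)} (ln(n+n0))^{1/(σ−1)}) for x ∈ D_n is positive on V and satisfies Δu(x) + u(x)^σ ≤ 0 for all x ∈ V. -/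

import Mathlib

open Real

/-- The power-logarithm `t ^ p * (log t) ^ q`. -/
noncomputable def powLog (p q t : ℝ) : ℝ := t ^ p * log t ^ q

section PowLog

variable {p q s t : ℝ}

lemma powLog_pos (p q : ℝ) (ht : 1 < t) : 0 < powLog p q t :=
  mul_pos (rpow_pos_of_pos (by linarith) _) (rpow_pos_of_pos (log_pos ht) _)

lemma powLog_le_powLog (hp : 0 ≤ p) (hq : 0 ≤ q) (hs : 1 < s) (hst : s ≤ t) :
    powLog p q s ≤ powLog p q t := by
  have hl := log_pos hs
  have := log_le_log (by linarith) hst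
  have : 0 ≤ t ^ p := rpow_nonneg (by linarith) _
  unfold powLog
  gcongr

lemma powLog_div_powLog_add_le {h : ℝ} (hp : 0 ≤ p) (hq : 0 ≤ q) (hs : 1 < s) (hst : s ≤ t)
    (hh : 0 ≤ h) :
    powLog p q s / powLog p q (s + h) ≤ powLog p q t / powLog p q (t + h) := by
  have key : ∀ x, 1 < x → powLog p q x / powLog p q (x + h) =
      (x / (x + h)) ^ p * (log x / log (x + h)) ^ q := fun x hx => by
    rw [div_rpow (by linarith) (by linarith), div_rpow (log_pos hx).le
      (log_nonneg (by linarith)), powLog, powLog, mul_div_mul_comm]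
  have hls := log_pos hs
  have hlt := log_pos (hs.trans_le hst)
  have hlsh : 0 < log (s + h) := log_pos (by linarith)
  have hlth : 0 < log (t + h) := log_pos (by linarith)
  have hfac : ∀ x, 1 < x → log (x + h) = log x + log (1 + h / x) := fun x hx => by
    have : 0 ≤ h / x := div_nonneg hh (by linarith)
    rw [← log_mul (by linarith) (by linarith), mul_add, mul_one, mul_div_cancel₀ _ (by linarith)]
  have h₁ : s / (s + h) ≤ t / (t + h) := by
    rw [div_le_div_iff₀ (by linarith) (by linarith)]
    nlinarith
  have h₂ : log s / log (s + h) ≤ log t / log (t + h) := by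
    rw [div_le_div_iff₀ hlsh hlth, hfac s hs, hfac t (hs.trans_le hst)]
    have hlog : log (1 + h / t) ≤ log (1 + h / s) := by
      have : 0 ≤ h / t := div_nonneg hh (by linarith)
      refine log_le_log (by linarith) ?_
      gcongr
    have h0 : 0 ≤ log (1 + h / t) :=
      log_nonneg (by have : 0 ≤ h / t := div_nonneg hh (by linarith)
                     linarith)
    have := mul_le_mul (log_le_log (by linarith) hst) hlog h0 hlt.le
    linarith
  rw [key s hs, key t (hs.trans_le hst)]
  have : 0 ≤ s / (s + h) := div_nonneg (by linarith) (by linarith)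
  have : 0 ≤ log s / log (s + h) := by positivity
  have : 0 ≤ (t / (t + h)) ^ p := rpow_nonneg (div_nonneg (by linarith) (by linarith)) _
  gcongr

lemma hasDerivAt_powLog (p q : ℝ) (ht : 1 < t) :
    HasDerivAt (powLog p q) (powLog (p - 1) (q - 1) t * (p * log t + q)) t := by
  have ht0 : 0 < t := by linarith
  have hl := log_pos ht
  have h := (hasDerivAt_rpow_const (p := p) (.inl ht0.ne')).mul
    ((hasDerivAt_log ht0.ne').rpow_const (p := q) (.inl hl.ne'))
  refine h.congr_deriv ?_
  rw [powLog, rpow_sub_one ht0.ne', rpow_sub_one hl.ne']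
  field_simp

lemma two_rpow_neg_abs_mul_rpow_le {x y : ℝ} (p : ℝ) (hy : 0 < y) (h₁ : y / 2 ≤ x)
    (h₂ : x ≤ 2 * y) : 2 ^ (-|p|) * y ^ p ≤ x ^ p := by
  have hx : 0 < x := by linarith
  have hxy : x = x / y * y := by field_simp
  have h₁' : 1 / 2 ≤ x / y := by rw [div_le_div_iff₀ two_pos hy]; linarith
  have h₂' : x / y ≤ 2 := by rwa [div_le_iff₀ hy]
  have h : (2 : ℝ) ^ (-|p|) ≤ (x / y) ^ p := by
    rcases le_total 0 p with hp | hp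
    · rw [abs_of_nonneg hp, rpow_neg two_pos.le, ← inv_rpow two_pos.le, ← one_div]
      gcongr
    · rw [abs_of_nonpos hp, neg_neg]
      exact rpow_le_rpow_of_nonpos (by positivity) h₂' hp
  rw [hxy, mul_rpow (by positivity) hy.le]
  gcongr

lemma log_div_two_le_log {x y : ℝ} (hy : 1 ≤ y) (h : y ≤ x ^ 2) :
    log y / 2 ≤ log x := by
  have := log_le_log (by linarith) h
  rw [log_pow] at this
  push_cast at this
  linarith

lemma log_le_two_mul_log {x y : ℝ} (hx : 0 < x) (h : x ≤ y ^ 2) :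
    log x ≤ 2 * log y := by
  have := log_le_log hx h
  rw [log_pow] at this
  exact_mod_cast this

lemma powLog_sub_one_ge (p q : ℝ) (ht : 3 ≤ t) :
    2 ^ (-|p|) * 2 ^ (-|q|) * powLog p q t ≤ powLog p q (t - 1) := by
  have hl : 0 < log t := log_pos (by linarith)
  have hl' : log (t - 1) ≤ log t := log_le_log (by linarith) (by linarith)
  have h₁ := two_rpow_neg_abs_mul_rpow_le (x := t - 1) (y := t) p (by linarith) (by linarith)
    (by linarith)
  have h₂ := two_rpow_neg_abs_mul_rpow_le (x := log (t - 1)) (y := log t) q hl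
    (log_div_two_le_log (by linarith) (by nlinarith)) (by linarith)
  have := rpow_nonneg hl.le q
  unfold powLog
  rw [mul_mul_mul_comm]
  have : 0 ≤ (t - 1) ^ p := rpow_nonneg (by linarith) _
  gcongr

/-- Increments of the flux `w (φ - φ(· + 1))`, where `w = powLog (a + 1) (b + ε)` and
`φ = powLog (-a) (-b)`, are bounded below. -/
lemma exists_forall_le_flux_sub {a b ε : ℝ} (ha : 0 < a) (hb : 0 < b) (hε : 0 < ε) :
    ∃ T c : ℝ, 0 < c ∧ ∀ t, T ≤ t → c * powLog (-1) (ε - 1) t ≤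
      powLog (a + 1) (b + ε) t * (powLog (-a) (-b) t - powLog (-a) (-b) (t + 1)) -
      powLog (a + 1) (b + ε) (t - 1) * (powLog (-a) (-b) (t - 1) - powLog (-a) (-b) t) := by
  set w := powLog (a + 1) (b + ε) with hw
  set φ := powLog (-a) (-b) with hφ
  set g : ℝ → ℝ := fun t => a * powLog 0 ε t + b * powLog 0 (ε - 1) t with hg
  set κ : ℝ := 2 ^ (-|a + 1|) * 2 ^ (-|b + ε|) with hκ
  set κ' : ℝ := 2 ^ (-|(-1 : ℝ)|) * 2 ^ (-|ε - 1|) with hκ'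
  have hwpos : ∀ {t}, 1 < t → 0 < w t := fun h => powLog_pos _ _ h
  have hφ' : ∀ t, 1 < t → HasDerivAt φ (-(g t / w t)) t := fun t ht => by
    refine (hasDerivAt_powLog (-a) (-b) ht).congr_deriv ?_
    have ht0 : 0 < t := by linarith
    have hl := log_pos ht
    have hw0 := (hwpos ht).ne'
    rw [eq_neg_iff_add_eq_zero, ← mul_right_inj' hw0, mul_add, mul_div_cancel₀ _ hw0, mul_zero]
    have : w t * powLog (-a - 1) (-b - 1) t = log t ^ (ε - 1) := by
      simp only [hw, powLog]
      rw [mul_mul_mul_comm, ← rpow_add ht0, ← rpow_add hl]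
      ring_nf
      simp
    rw [← mul_assoc, this]
    simp only [hg, powLog, rpow_zero, one_mul]
    rw [rpow_sub_one hl.ne']
    field_simp
    ring
  have hg' : ∀ t, 1 < t → HasDerivAt g
      (powLog (-1) (ε - 1) t * (a * ε) + powLog (-1) (ε - 2) t * (b * (ε - 1))) t :=
    fun t ht => by
      refine (((hasDerivAt_powLog 0 ε ht).const_mul a).add
        ((hasDerivAt_powLog 0 (ε - 1) ht).const_mul b)).congr_deriv ?_
      rw [zero_sub, sub_sub, one_add_one_eq_two]
      ring
  refine ⟨max 3 (exp (2 * b / (a * ε)) + 1), κ * (a * ε / 2 * κ'), by positivity,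
    fun t ht => ?_⟩
  have ht3 : 3 ≤ t := (le_max_left _ _).trans ht
  have htE : exp (2 * b / (a * ε)) ≤ t - 1 := by linarith [(le_max_right _ _).trans ht]
  have hg'le : ∀ η, t - 1 < η → η < t + 1 → a * ε / 2 * κ' * powLog (-1) (ε - 1) t ≤
      powLog (-1) (ε - 1) η * (a * ε) + powLog (-1) (ε - 2) η * (b * (ε - 1)) := by
    intro η h₁ h₂
    have hη : 1 < η := by linarith
    have hl := log_pos hη
    have hL : 2 * b / (a * ε) ≤ log η := by
      rw [le_log_iff_exp_le (by linarith)]; linarith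
    rw [div_le_iff₀ (by positivity)] at hL
    have hP : powLog (-1) (ε - 1) η = powLog (-1) (ε - 2) η * log η := by
      simp only [powLog]
      rw [mul_assoc, ← rpow_add_one hl.ne']
      ring_nf
    have hcmp : κ' * powLog (-1) (ε - 1) t ≤ powLog (-1) (ε - 1) η := by
      have hlt : 0 < log t := log_pos (by linarith)
      have e₁ := two_rpow_neg_abs_mul_rpow_le (x := η) (y := t) (-1) (by linarith) (by linarith)
        (by linarith)
      have e₂ := two_rpow_neg_abs_mul_rpow_le (x := log η) (y := log t) (ε - 1) hlt
        (log_div_two_le_log (by linarith) (by nlinarith))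
        (log_le_two_mul_log (by linarith) (by nlinarith))
      rw [hκ', powLog, mul_mul_mul_comm, powLog]
      have := rpow_nonneg hlt.le (ε - 1)
      have : 0 ≤ η ^ (-1 : ℝ) := rpow_nonneg (by linarith) _
      gcongr
    have hpos : 0 < powLog (-1) (ε - 2) η := powLog_pos _ _ hη
    calc a * ε / 2 * κ' * powLog (-1) (ε - 1) t
        = a * ε / 2 * (κ' * powLog (-1) (ε - 1) t) := by ring
      _ ≤ a * ε / 2 * powLog (-1) (ε - 1) η := by gcongr
      _ ≤ _ := by
        rw [hP]
        nlinarith [mul_pos hb hε]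
  set H : ℝ → ℝ := fun h => w t * (φ t - φ (t + h)) - w (t - 1) * (φ (t - 1) - φ (t - 1 + h))
    with hH
  have hHd : ∀ h, 0 ≤ h → HasDerivAt H
      (w t * (g (t + h) / w (t + h)) - w (t - 1) * (g (t - 1 + h) / w (t - 1 + h))) h := by
    intro h hh
    have e₁ := (((hφ' (t + h) (by linarith)).comp_const_add t h).const_sub (φ t)).const_mul (w t)
    have e₂ := (((hφ' (t - 1 + h) (by linarith)).comp_const_add (t - 1) h).const_sub
      (φ (t - 1))).const_mul (w (t - 1))
    refine (e₁.sub e₂).congr_deriv ?_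
    rw [neg_neg, neg_neg]
  obtain ⟨ξ, hξ, hHξ⟩ := exists_hasDerivAt_eq_slope H _ zero_lt_one
    (fun h hh => (hHd h hh.1).continuousAt.continuousWithinAt) (fun h hh => hHd h hh.1.le)
  obtain ⟨η, hη, hgη⟩ := exists_hasDerivAt_eq_slope g _
    (show t - 1 + ξ < t + ξ by linarith)
    (fun h hh => (hg' h (by linarith [hξ.1, hh.1])).continuousAt.continuousWithinAt)
    (fun h hh => hg' h (by linarith [hξ.1, hh.1]))
  have hgle := hg'le η (by linarith [hξ.1, hη.1]) (by linarith [hξ.2, hη.2])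
  rw [hgη, show t + ξ - (t - 1 + ξ) = 1 by ring, div_one] at hgle
  have hH0 : H 0 = 0 := by simp [hH]
  have hH1 : H 1 = w t * (φ t - φ (t + 1)) - w (t - 1) * (φ (t - 1) - φ t) := by simp [hH]
  rw [hH0, sub_zero, sub_zero, div_one] at hHξ
  rw [← hH1, ← hHξ]
  have hr := powLog_div_powLog_add_le (p := a + 1) (q := b + ε) (s := t - 1) (t := t) (h := ξ)
    (by positivity) (by positivity) (by linarith) (by linarith) hξ.1.le
  have hwξ := hwpos (show 1 < t - 1 + ξ by linarith [hξ.1])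
  have hrκ : κ ≤ w (t - 1) / w (t - 1 + ξ) := by
    rw [le_div_iff₀ hwξ]
    refine le_trans ?_ (powLog_sub_one_ge (a + 1) (b + ε) ht3)
    have : w (t - 1 + ξ) ≤ w t := powLog_le_powLog (by positivity) (by positivity)
      (by linarith [hξ.1]) (by linarith [hξ.2])
    gcongr
  have hgpos : 0 ≤ g (t + ξ) := by
    have h : 1 < t + ξ := by linarith [hξ.1]
    have := powLog_pos 0 ε h
    have := powLog_pos 0 (ε - 1) h
    simp only [hg]
    positivity
  have hPpos := powLog_pos (-1) (ε - 1) (show 1 < t by linarith)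
  calc κ * (a * ε / 2 * κ') * powLog (-1) (ε - 1) t
      = κ * (a * ε / 2 * κ' * powLog (-1) (ε - 1) t) := by ring
    _ ≤ w (t - 1) / w (t - 1 + ξ) * (g (t + ξ) - g (t - 1 + ξ)) := by
      refine mul_le_mul hrκ hgle (by positivity) ?_
      exact (div_pos (hwpos (by linarith)) hwξ).le
    _ ≤ w t / w (t + ξ) * g (t + ξ) - w (t - 1) / w (t - 1 + ξ) * g (t - 1 + ξ) := by
      rw [mul_sub]
      gcongr
    _ = _ := by ring

lemma exists_forall_le_flux_sub_rpow {a b ε σ : ℝ} (ha : 0 < a) (hb : 0 < b) (hε : 0 < ε)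
    (haσ : a * σ = a + 2) (hbσ : b * σ = b + 1) :
    ∃ T c : ℝ, 0 < c ∧ ∀ t, T ≤ t →
      c * powLog (-a) (-b) t ^ σ * (powLog (a + 1) (b + ε) t + powLog (a + 1) (b + ε) (t - 1)) ≤
      powLog (a + 1) (b + ε) t * (powLog (-a) (-b) t - powLog (-a) (-b) (t + 1)) -
      powLog (a + 1) (b + ε) (t - 1) * (powLog (-a) (-b) (t - 1) - powLog (-a) (-b) t) := by
  obtain ⟨T, c, hc, h⟩ := exists_forall_le_flux_sub ha hb hε
  refine ⟨max T 3, c / 2, by positivity, fun t ht => le_trans ?_ (h t ((le_max_left _ _).trans ht))⟩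
  have ht3 : 3 ≤ t := (le_max_right _ _).trans ht
  have ht0 : 0 < t := by linarith
  have hl : 0 < log t := log_pos (by linarith)
  have hφ := rpow_pos_of_pos (powLog_pos (-a) (-b) (show 1 < t by linarith)) σ
  have hw : powLog (a + 1) (b + ε) (t - 1) ≤ powLog (a + 1) (b + ε) t :=
    powLog_le_powLog (by positivity) (by positivity) (by linarith) (by linarith)
  have hid : powLog (-a) (-b) t ^ σ * powLog (a + 1) (b + ε) t = powLog (-1) (ε - 1) t := by
    simp only [powLog]
    rw [mul_rpow (by positivity) (by positivity), ← rpow_mul ht0.le, ← rpow_mul hl.le,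
      mul_mul_mul_comm, ← rpow_add ht0, ← rpow_add hl]
    congr 2 <;> linarith
  rw [← hid]
  calc _ ≤ c / 2 * powLog (-a) (-b) t ^ σ *
        (powLog (a + 1) (b + ε) t + powLog (a + 1) (b + ε) t) := by gcongr
    _ = _ := by ring

lemma powLog_neg_lt_powLog_neg {a b : ℝ} (ha : 0 < a) (hb : 0 < b) (hs : 1 < s) (hst : s < t) :
    powLog (-a) (-b) t < powLog (-a) (-b) s := by
  have hl := log_pos hs
  have hlt := log_lt_log (by linarith) hst
  exact mul_lt_mul'' (rpow_lt_rpow_of_neg (by linarith) hst (by linarith))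
    (rpow_lt_rpow_of_neg hl hlt (by linarith)) (rpow_nonneg (by linarith) _)
    (rpow_nonneg (by linarith) _)

/-- Sums of a sequence comparable to `powLog p q` are comparable to `powLog (p + 1) q`. -/
lemma exists_sum_range_bounds (hp : 0 ≤ p) (hq : 0 ≤ q) {n₀ : ℕ} (hn₀ : 2 ≤ n₀) {S : ℕ → ℝ}
    {A B : ℝ} (hA : 0 < A) (hB : 0 < B) (hl : ∀ k : ℕ, A * powLog p q (k + n₀ : ℕ) ≤ S k)
    (hu : ∀ k : ℕ, S k ≤ B * powLog p q (k + n₀ : ℕ)) :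
    ∃ c C : ℝ, 0 < c ∧ 0 < C ∧ ∀ n : ℕ, 2 ≤ n →
      c * powLog (p + 1) q n ≤ ∑ k ∈ Finset.range (n + 1), S k ∧
      ∑ k ∈ Finset.range (n + 1), S k ≤ C * powLog (p + 1) q n := by
  have hn₀' : (2 : ℝ) ≤ n₀ := by exact_mod_cast hn₀
  have hlog2 : 0 < log 2 := log_pos one_lt_two
  set K : ℝ := log (1 + n₀) / log 2 + 1 with hK
  have hKpos : 0 < K := by
    have : 0 < log (1 + n₀ : ℝ) := log_pos (by linarith)
    positivity
  refine ⟨1 / 2 * (A * ((1 / 2) ^ p * (1 / 2) ^ q)), 2 * (B * ((1 + n₀ : ℝ) ^ p * K ^ q)),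
    by positivity, by positivity, fun n hn => ?_⟩
  have hn2 : (2 : ℝ) ≤ n := by exact_mod_cast hn
  have hn0 : (0 : ℝ) < n := by linarith
  have hln : 0 < log (n : ℝ) := log_pos (by linarith)
  have hS : ∀ k, 0 ≤ S k := fun k =>
    (mul_pos hA (powLog_pos p q (by push_cast; linarith [k.cast_nonneg (α := ℝ)]))).le.trans (hl k)
  constructor
  · have hsub : Finset.Ico ((n + 1) / 2) (n + 1) ⊆ Finset.range (n + 1) := fun k hk =>
      Finset.mem_range.2 (Finset.mem_Ico.1 hk).2
    refine le_trans ?_ (Finset.sum_le_sum_of_subset_of_nonneg hsub fun k _ _ => hS k)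
    have hterm : ∀ k ∈ Finset.Ico ((n + 1) / 2) (n + 1),
        A * ((1 / 2) ^ p * (1 / 2) ^ q) * powLog p q n ≤ S k := by
      intro k hk
      have hk' : n ≤ 2 * k := by have := (Finset.mem_Ico.1 hk).1; omega
      have hk'' : (n : ℝ) ≤ 2 * k := by exact_mod_cast hk'
      have hlog : log (n : ℝ) / 2 ≤ log (k + n₀ : ℝ) :=
        log_div_two_le_log (by linarith) (by nlinarith)
      refine le_trans ?_ (hl k)
      rw [mul_assoc]
      refine mul_le_mul_of_nonneg_left ?_ hA.le
      rw [powLog, mul_mul_mul_comm, ← mul_rpow (by norm_num) hn0.le,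
        ← mul_rpow (by norm_num) hln.le, powLog]
      push_cast
      refine mul_le_mul (rpow_le_rpow (by positivity) (by linarith) hp)
        (rpow_le_rpow (by positivity) (by linarith) hq) (by positivity) (by positivity)
    refine le_trans ?_ (Finset.card_nsmul_le_sum _ _ _ hterm)
    have hcard : (n : ℝ) / 2 ≤ (n + 1 - (n + 1) / 2 : ℕ) := by
      rw [div_le_iff₀ two_pos]
      have : n ≤ (n + 1 - (n + 1) / 2) * 2 := by omega
      exact_mod_cast this
    rw [Nat.card_Ico, nsmul_eq_mul]
    have hP := powLog_pos p q (show (1 : ℝ) < n by linarith)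
    calc _ = (n : ℝ) / 2 * (A * ((1 / 2) ^ p * (1 / 2) ^ q) * powLog p q n) := by
          rw [powLog, powLog, rpow_add_one hn0.ne']; ring
      _ ≤ _ := by gcongr
  · have hterm : ∀ k ∈ Finset.range (n + 1),
        S k ≤ B * ((1 + n₀ : ℝ) ^ p * K ^ q) * powLog p q n := by
      intro k hk
      have hk' : (k : ℝ) ≤ n := by exact_mod_cast Nat.lt_succ_iff.1 (Finset.mem_range.1 hk)
      have hk0 : (0 : ℝ) ≤ k := k.cast_nonneg
      have hkn : (k : ℝ) + n₀ ≤ (1 + n₀) * n := by nlinarith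
      have hlog : log (k + n₀ : ℝ) ≤ K * log n := by
        calc _ ≤ log ((1 + n₀ : ℝ) * n) := log_le_log (by linarith) hkn
          _ = log (1 + n₀ : ℝ) / log 2 * log 2 + log n := by
            rw [log_mul (by positivity) (by positivity), div_mul_cancel₀ _ hlog2.ne']
          _ ≤ log (1 + n₀ : ℝ) / log 2 * log n + log n := by
            have : 0 ≤ log (1 + n₀ : ℝ) := log_nonneg (by linarith)
            gcongr
          _ = K * log n := by rw [hK]; ring
      have hlk : 0 ≤ log (k + n₀ : ℝ) := log_nonneg (by linarith)
      refine (hu k).trans ?_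
      rw [mul_assoc]
      refine mul_le_mul_of_nonneg_left ?_ hB.le
      rw [powLog, powLog, mul_mul_mul_comm, ← mul_rpow (by positivity) hn0.le,
        ← mul_rpow hKpos.le hln.le]
      push_cast
      refine mul_le_mul (rpow_le_rpow (by positivity) hkn hp)
        (rpow_le_rpow hlk hlog hq) (by positivity) (by positivity)
    refine (Finset.sum_le_card_nsmul _ _ _ hterm).trans ?_
    rw [Finset.card_range, nsmul_eq_mul]
    have hP := powLog_pos p q (show (1 : ℝ) < n by linarith)
    calc _ ≤ (2 * n : ℝ) * (B * ((1 + n₀ : ℝ) ^ p * K ^ q) * powLog p q n) := by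
          gcongr
          push_cast
          linarith
      _ = _ := by rw [powLog, powLog, rpow_add_one hn0.ne']; ring

end PowLog

lemma finsum_mem_eq_ncard_mul {α R : Type*} [Semiring R] {s : Set α} (hs : s.Finite) {f : α → R}
    {c : R} (hf : ∀ x ∈ s, f x = c) : ∑ᶠ x ∈ s, f x = s.ncard * c := by
  rw [finsum_mem_congr rfl hf, finsum_mem_eq_finite_toFinset_sum _ hs, Finset.sum_const,
    nsmul_eq_mul, Set.ncard_eq_toFinset_card _ hs]

namespace SimpleGraph

variable {V : Type*} {G : SimpleGraph V}

lemma IsTree.eq_of_adj_of_dist_add_one_eq (hG : G.IsTree) {o x y z : V}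
    (hy : G.Adj x y) (hz : G.Adj x z) (hdy : G.dist o y + 1 = G.dist o x)
    (hdz : G.dist o z + 1 = G.dist o x) : y = z := by
  obtain ⟨p, -, hp⟩ := hG.connected.exists_path_of_dist o y
  obtain ⟨q, -, hq⟩ := hG.connected.exists_path_of_dist o z
  have hp' : (p.concat hy.symm).IsPath :=
    Walk.isPath_of_length_eq_dist _ (by rw [Walk.length_concat, hp, hdy])
  have hq' : (q.concat hz.symm).IsPath :=
    Walk.isPath_of_length_eq_dist _ (by rw [Walk.length_concat, hq, hdz])
  have h := (hG.existsUnique_path o x).unique hp' hq'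
  simpa using congrArg Walk.penultimate h

lemma IsTree.exists_adj_dist_add_one_eq (hG : G.IsTree) {o x : V} (hx : x ≠ o) :
    ∃ p, G.Adj x p ∧ G.dist o p + 1 = G.dist o x := by
  obtain ⟨w, -, hw⟩ := hG.connected.exists_path_of_dist o x
  have hn : ¬ w.Nil := fun h => hx h.eq.symm
  refine ⟨w.penultimate, (w.adj_penultimate hn).symm, ?_⟩
  have h₁ := G.dist_le w.dropLast
  have h₂ : w.dropLast.length + 1 = w.length := w.length_dropLast_add_one hn
  rcases hG.dist_eq_dist_add_one_of_adj o (w.adj_penultimate hn) with h | h <;> omega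

/-- The neighbours of `x` one step further from the root `o` than `x`. -/
def children (G : SimpleGraph V) (o x : V) : Set V :=
  {y | G.Adj x y ∧ G.dist o y = G.dist o x + 1}

lemma setOf_adj_root (o : V) :
    {y | G.Adj o y} = G.children o o := by
  ext y
  simp only [children, Set.mem_ofPred_eq, dist_self, zero_add, iff_self_and]
  exact fun h => dist_eq_one_iff_adj.2 h

lemma IsTree.setOf_adj_of_parent (hG : G.IsTree) {o x p : V} (hp : G.Adj x p)
    (hd : G.dist o p + 1 = G.dist o x) :
    {y | G.Adj x y} = insert p (G.children o x) := by
  ext y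
  simp only [children, Set.mem_ofPred_eq, Set.mem_insert_iff]
  constructor
  · intro h
    rcases hG.dist_eq_dist_add_one_of_adj o h with h' | h'
    · exact .inl (hG.eq_of_adj_of_dist_add_one_eq h hp h'.symm hd)
    · exact .inr ⟨h, h'⟩
  · rintro (rfl | h)
    exacts [hp, h.1]

lemma notMem_children_of_parent {o x p : V} (hd : G.dist o p + 1 = G.dist o x) :
    p ∉ G.children o x := fun h => by
  have := h.2
  omega

/-- The sphere of radius `n` about `o`. -/
def sphere (G : SimpleGraph V) (o : V) (n : ℕ) : Set V := {x | G.dist o x = n}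

section Regular

variable {N : ℕ}

lemma finite_setOf_adj (hN : 2 ≤ N) (hdeg : ∀ x : V, {y | G.Adj x y}.ncard = N) (x : V) :
    {y | G.Adj x y}.Finite :=
  Set.finite_of_ncard_pos (by rw [hdeg]; omega)

lemma ncard_children_root (hdeg : ∀ x : V, {y | G.Adj x y}.ncard = N)
    (o : V) : (G.children o o).ncard = N := by
  rw [← setOf_adj_root, hdeg]

lemma finite_children (hN : 2 ≤ N) (hdeg : ∀ x : V, {y | G.Adj x y}.ncard = N) (o x : V) :
    (G.children o x).Finite :=
  (finite_setOf_adj hN hdeg x).subset fun _ h => h.1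

lemma IsTree.ncard_children (hG : G.IsTree) (hN : 2 ≤ N)
    (hdeg : ∀ x : V, {y | G.Adj x y}.ncard = N) {o x : V} (hx : x ≠ o) :
    (G.children o x).ncard = N - 1 := by
  obtain ⟨p, hp, hd⟩ := hG.exists_adj_dist_add_one_eq hx
  have h := hdeg x
  rw [hG.setOf_adj_of_parent hp hd, Set.ncard_insert_of_notMem (notMem_children_of_parent hd)
    (finite_children hN hdeg o x)] at h
  omega

lemma finsum_root (hN : 2 ≤ N)
    (hdeg : ∀ x : V, {y | G.Adj x y}.ncard = N) {o : V} {F : V → ℝ} {α : ℝ}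
    (hF : ∀ y, ¬ G.Adj o y → F y = 0) (hα : ∀ y ∈ G.children o o, F y = α) :
    ∑ᶠ y, F y = N * α := by
  have h : ∑ᶠ y ∈ {y | G.Adj o y}, F y = ∑ᶠ y, F y :=
    (finsum_mem_inter_support_eq' F _ Set.univ fun y hy => by
      simpa using not_imp_comm.1 (hF y) hy).trans (finsum_mem_univ F)
  rw [← h, setOf_adj_root, finsum_mem_eq_ncard_mul (finite_children hN hdeg o _) hα, ncard_children_root hdeg]

lemma IsTree.finsum_of_parent (hG : G.IsTree) (hN : 2 ≤ N)
    (hdeg : ∀ x : V, {y | G.Adj x y}.ncard = N) {o x : V} (hx : x ≠ o) {F : V → ℝ} {α β : ℝ}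
    (hF : ∀ y, ¬ G.Adj x y → F y = 0) (hα : ∀ y ∈ G.children o x, F y = α)
    (hβ : ∀ y, G.Adj x y → G.dist o y + 1 = G.dist o x → F y = β) :
    ∑ᶠ y, F y = β + (N - 1) * α := by
  obtain ⟨p, hp, hd⟩ := hG.exists_adj_dist_add_one_eq hx
  have h : ∑ᶠ y ∈ {y | G.Adj x y}, F y = ∑ᶠ y, F y :=
    (finsum_mem_inter_support_eq' F _ Set.univ fun y hy => by
      simpa using not_imp_comm.1 (hF y) hy).trans (finsum_mem_univ F)
  rw [← h, hG.setOf_adj_of_parent hp hd, finsum_mem_insert _ (notMem_children_of_parent hd)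
    (finite_children hN hdeg o x), finsum_mem_eq_ncard_mul (finite_children hN hdeg o _) hα,
    hG.ncard_children hN hdeg hx, hβ p hp hd, Nat.cast_sub (by omega), Nat.cast_one]

lemma Connected.sphere_zero (hG : G.Connected) (o : V) : G.sphere o 0 = {o} := by
  ext x
  simp [sphere, hG.dist_eq_zero_iff, eq_comm]

lemma IsTree.sphere_succ (hG : G.IsTree) (o : V) (n : ℕ) :
    G.sphere o (n + 1) = ⋃ x ∈ G.sphere o n, G.children o x := by
  ext y
  simp only [sphere, children, Set.mem_ofPred_eq, Set.mem_iUnion, exists_prop]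
  constructor
  · intro h
    have hy : y ≠ o := by rintro rfl; simp at h
    obtain ⟨p, hp, hd⟩ := hG.exists_adj_dist_add_one_eq hy
    exact ⟨p, by omega, hp.symm, by omega⟩
  · rintro ⟨x, hx, -, h⟩
    omega

lemma IsTree.pairwise_disjoint_children (hG : G.IsTree) (o : V) :
    Pairwise (Function.onFun Disjoint (G.children o)) := fun _ _ hxy =>
  Set.disjoint_left.2 fun _ hx hy =>
    hxy (hG.eq_of_adj_of_dist_add_one_eq hx.1.symm hy.1.symm hx.2.symm hy.2.symm)

lemma IsTree.finite_sphere (hG : G.IsTree) (hN : 2 ≤ N)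
    (hdeg : ∀ x : V, {y | G.Adj x y}.ncard = N) (o : V) (n : ℕ) : (G.sphere o n).Finite := by
  induction n with
  | zero => simp [hG.connected.sphere_zero]
  | succ n ih =>
    rw [hG.sphere_succ]
    exact ih.biUnion fun x _ => finite_children hN hdeg o x

lemma IsTree.ncard_sphere_succ (hG : G.IsTree) (hN : 2 ≤ N)
    (hdeg : ∀ x : V, {y | G.Adj x y}.ncard = N) (o : V) (n : ℕ) :
    (G.sphere o (n + 1)).ncard = N * (N - 1) ^ n := by
  have key : ∀ n c, (∀ x ∈ G.sphere o n, (G.children o x).ncard = c) →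
      (G.sphere o (n + 1)).ncard = (G.sphere o n).ncard * c := fun n c hc => by
    rw [hG.sphere_succ, (hG.finite_sphere hN hdeg o n).ncard_biUnion
      (fun x _ => finite_children hN hdeg o x)
      ((hG.pairwise_disjoint_children o).set_pairwise _),
      finsum_mem_eq_ncard_mul (hG.finite_sphere hN hdeg o n) hc, Nat.cast_id]
  induction n with
  | zero =>
    rw [key 0 N, hG.connected.sphere_zero, Set.ncard_singleton, pow_zero, one_mul, mul_one]
    simp only [hG.connected.sphere_zero, Set.mem_singleton_iff, forall_eq]
    exact ncard_children_root hdeg o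
  | succ n ih =>
    rw [key (n + 1) (N - 1), ih, pow_succ, mul_assoc]
    rintro x hx
    exact hG.ncard_children hN hdeg (by rintro rfl; simp [sphere] at hx)

lemma IsTree.finsum_ball (hG : G.IsTree) (hN : 2 ≤ N)
    (hdeg : ∀ x : V, {y | G.Adj x y}.ncard = N) (o : V) {f : V → ℝ} {g : ℕ → ℝ}
    (hf : ∀ x, f x = g (G.dist o x)) (n : ℕ) :
    ∑ᶠ x ∈ {x : V | G.dist o x ≤ n}, f x =
      ∑ k ∈ Finset.range (n + 1), ((G.sphere o k).ncard : ℝ) * g k := by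
  have hU : {x : V | G.dist o x ≤ n} = ⋃ k ∈ (Finset.range (n + 1) : Set ℕ), G.sphere o k := by
    ext x
    simp [sphere]
  have hdisj : ∀ i j, i ≠ j → Disjoint (G.sphere o i) (G.sphere o j) := fun i j hij =>
    Set.disjoint_left.2 fun x (hi : _ = _) (hj : _ = _) => hij (hi.symm.trans hj)
  rw [hU, finsum_mem_biUnion (fun i _ j _ hij => hdisj i j hij) (Finset.finite_toSet _)
    (fun k _ => hG.finite_sphere hN hdeg o k), finsum_mem_coe_finset]
  exact Finset.sum_congr rfl fun k _ => finsum_mem_eq_ncard_mul (hG.finite_sphere hN hdeg o k)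
    fun x hx => (hf x).trans (congrArg g hx)

end Regular

end SimpleGraph

/-- the sharpness example on the homogeneous tree T_N. There are
n0 ≥ 2 and δ > 0 such that for the edge weights
μ_{xy} = (n+n0)^{(σ+1)/(σ-1)} (ln(n+n0))^{1/(σ-1)+ε} / (N-1)^n on edges of E_n
(an edge of E_n joins D_n to D_{n+1}, so n = min(d(o,x), d(o,y))):
(i) μ(B(o,n)) ≍ n^{2σ/(σ-1)} (ln n)^{1/(σ-1)+ε} for n ≥ 2, and
(ii) u(x) = δ/((n+n0)^{2/(σ-1)} (ln(n+n0))^{1/(σ-1)}) for x ∈ D_n is a positive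
solution of Δu + u^σ ≤ 0 on V. -/
theorem stmt_13 {V : Type*} [Infinite V] (G : SimpleGraph V)
    (hconn : G.Connected) (hacyclic : G.IsAcyclic)
    (N : ℕ) (hN : 2 ≤ N) (hdeg : ∀ x : V, {y | G.Adj x y}.ncard = N)
    (o : V) (σ ε : ℝ) (hσ : 1 < σ) (hε : 0 < ε) :
    ∃ (n0 : ℕ) (δ : ℝ), 2 ≤ n0 ∧ 0 < δ ∧
      ∀ μ : V → V → ℝ,
        (∀ x y, G.Adj x y →
          μ x y = ((min (G.dist o x) (G.dist o y) + n0 : ℕ) : ℝ) ^ ((σ + 1) / (σ - 1)) *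
              Real.log ((min (G.dist o x) (G.dist o y) + n0 : ℕ) : ℝ) ^ (1 / (σ - 1) + ε) /
              ((N : ℝ) - 1) ^ (min (G.dist o x) (G.dist o y))) →
        (∀ x y, ¬ G.Adj x y → μ x y = 0) →
        ((∃ c C : ℝ, 0 < c ∧ 0 < C ∧ ∀ n : ℕ, 2 ≤ n →
            c * (n : ℝ) ^ (2 * σ / (σ - 1)) * Real.log n ^ (1 / (σ - 1) + ε) ≤
              (∑ᶠ x ∈ {x : V | G.dist o x ≤ n}, ∑ᶠ y, μ x y) ∧
            (∑ᶠ x ∈ {x : V | G.dist o x ≤ n}, ∑ᶠ y, μ x y) ≤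
              C * (n : ℝ) ^ (2 * σ / (σ - 1)) * Real.log n ^ (1 / (σ - 1) + ε)) ∧
          ∀ u : V → ℝ,
            (∀ x, u x = δ / (((G.dist o x + n0 : ℕ) : ℝ) ^ (2 / (σ - 1)) *
                Real.log ((G.dist o x + n0 : ℕ) : ℝ) ^ (1 / (σ - 1)))) →
            (∀ x, 0 < u x) ∧
              ∀ x, (∑ᶠ y, μ x y * (u y - u x)) / (∑ᶠ y, μ x y) + u x ^ σ ≤ 0) := by
  have hG : G.IsTree := ⟨hconn, hacyclic⟩
  have hσ1 : 0 < σ - 1 := by linarith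
  set a := 2 / (σ - 1) with ha
  set b := 1 / (σ - 1) with hb
  have ha0 : 0 < a := by positivity
  have hb0 : 0 < b := by positivity
  have hp : (σ + 1) / (σ - 1) = a + 1 := by rw [ha]; field_simp; ring
  have hp' : 2 * σ / (σ - 1) = a + 1 + 1 := by rw [ha]; field_simp; ring
  obtain ⟨T, c, hc, hT⟩ := exists_forall_le_flux_sub_rpow (σ := σ) ha0 hb0 hε
    (by rw [ha]; field_simp; ring) (by rw [hb]; field_simp; ring)
  set n₀ : ℕ := max 2 ⌈T⌉₊ with hn₀
  have hn₀2 : 2 ≤ n₀ := le_max_left _ _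
  have hn₀T : T ≤ n₀ := (Nat.le_ceil T).trans (by exact_mod_cast le_max_right _ _)
  have hone : ∀ k : ℕ, (1 : ℝ) < (k + n₀ : ℕ) := fun k => by exact_mod_cast (by omega)
  set w : ℕ → ℝ := fun k => powLog (a + 1) (b + ε) (k + n₀ : ℕ) with hw
  set φ : ℕ → ℝ := fun k => powLog (-a) (-b) (k + n₀ : ℕ) with hφ
  have hwpos : ∀ k, 0 < w k := fun k => powLog_pos _ _ (hone k)
  have hwmono : ∀ k, w k ≤ w (k + 1) := fun k =>
    powLog_le_powLog (by positivity) (by positivity) (hone k) (by push_cast; linarith)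
  have hφpos : ∀ k, 0 < φ k := fun k => powLog_pos _ _ (hone k)
  have hφlt : φ 1 < φ 0 := powLog_neg_lt_powLog_neg ha0 hb0 (hone 0) (by push_cast; linarith)
  have hflux : ∀ k, c * φ (k + 1) ^ σ * (w (k + 1) + w k) ≤
      w (k + 1) * (φ (k + 1) - φ (k + 2)) - w k * (φ k - φ (k + 1)) := fun k => by
    have h := hT ((k + 1 : ℕ) + n₀ : ℕ) (by push_cast; linarith [k.cast_nonneg (α := ℝ)])
    have e₁ : (((k + 1 : ℕ) + n₀ : ℕ) : ℝ) - 1 = (k + n₀ : ℕ) := by push_cast; ring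
    have e₂ : (((k + 1 : ℕ) + n₀ : ℕ) : ℝ) + 1 = ((k + 2 : ℕ) + n₀ : ℕ) := by push_cast; ring
    rw [e₁, e₂] at h
    exact h
  have hφσ : 0 < φ 0 ^ σ := rpow_pos_of_pos (hφpos 0) σ
  set δ₀ := min c ((φ 0 - φ 1) / φ 0 ^ σ) with hδ₀
  have hδ₀pos : 0 < δ₀ := lt_min hc (div_pos (by linarith) hφσ)
  set δ := δ₀ ^ b with hδ
  have hδpos : 0 < δ := rpow_pos_of_pos hδ₀pos _
  have hδσ : δ ^ σ = δ * δ₀ := by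
    rw [hδ, ← rpow_mul hδ₀pos.le, ← rpow_add_one hδ₀pos.ne']
    congr 1
    rw [hb]; field_simp; ring
  have hNR : (2 : ℝ) ≤ N := by exact_mod_cast hN
  have hN1 : 0 < (N : ℝ) - 1 := by linarith
  refine ⟨n₀, δ, hn₀2, hδpos, fun μ hμ hμ0 => ?_⟩
  rw [hp] at hμ
  have hμchild : ∀ x, ∀ y ∈ G.children o x,
      μ x y = w (G.dist o x) / ((N : ℝ) - 1) ^ G.dist o x := fun x y hy => by
    rw [hμ x y hy.1, hy.2, min_eq_left (Nat.le_succ _)]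
    rfl
  have hμparent : ∀ x y k, G.Adj x y → G.dist o y = k → G.dist o x = k + 1 →
      μ x y = w k / ((N : ℝ) - 1) ^ k := fun x y k h hy hx => by
    rw [hμ x y h, hx, hy, min_eq_right (Nat.le_succ _)]
    rfl
  have hne : ∀ x k, G.dist o x = k + 1 → x ≠ o := by
    rintro x k h rfl
    simp at h
  have hm0 : ∑ᶠ y, μ o y = N * w 0 := by
    rw [G.finsum_root hN hdeg (hμ0 o) (hμchild o)]
    simp
  have hm1 : ∀ x k, G.dist o x = k + 1 →
      ∑ᶠ y, μ x y = (w (k + 1) + w k) / ((N : ℝ) - 1) ^ k := fun x k hx => by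
    rw [hG.finsum_of_parent hN hdeg (hne x k hx) (hμ0 x) (hμchild x)
      (fun y h hy => hμparent x y k h (by omega) hx), hx, pow_succ]
    field_simp
    ring
  constructor
  · set g : ℕ → ℝ := fun k => Nat.casesOn k (N * w 0)
      fun k => (w (k + 1) + w k) / ((N : ℝ) - 1) ^ k with hg
    have hmg : ∀ x, ∑ᶠ y, μ x y = g (G.dist o x) := fun x => by
      rcases hx : G.dist o x with _ | k
      · obtain rfl := hconn.dist_eq_zero_iff.1 hx
        exact hm0
      · exact hm1 x k hx
    have hS0 : ((G.sphere o 0).ncard : ℝ) * g 0 = N * w 0 := by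
      rw [hconn.sphere_zero, Set.ncard_singleton, Nat.cast_one, one_mul]
      rfl
    have hS1 : ∀ k, ((G.sphere o (k + 1)).ncard : ℝ) * g (k + 1) = N * (w (k + 1) + w k) :=
      fun k => by
        rw [hG.ncard_sphere_succ hN hdeg, Nat.cast_mul, Nat.cast_pow, Nat.cast_sub (by omega),
          Nat.cast_one, mul_assoc]
        simp only [hg]
        rw [mul_div_cancel₀ _ (by positivity)]
    obtain ⟨c', C', hc', hC', h⟩ := exists_sum_range_bounds (p := a + 1) (q := b + ε)
      (by positivity) (by positivity) hn₀2 (S := fun k => ((G.sphere o k).ncard : ℝ) * g k)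
      (A := N) (B := 2 * N) (by linarith) (by linarith)
      (fun k => by
        change (N : ℝ) * w k ≤ _
        rcases k with _ | k
        · exact hS0.ge
        · refine le_trans ?_ (hS1 k).ge
          gcongr
          linarith [hwpos k])
      (fun k => by
        change _ ≤ 2 * (N : ℝ) * w k
        rcases k with _ | k
        · refine hS0.le.trans ?_
          nlinarith [hwpos 0]
        · refine (hS1 k).le.trans ?_
          nlinarith [hwmono k])
    refine ⟨c', C', hc', hC', fun n hn => ?_⟩
    rw [hG.finsum_ball hN hdeg o hmg n, hp', mul_assoc, mul_assoc]
    exact h n hn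
  · intro u hu
    have hu' : ∀ x, u x = δ * φ (G.dist o x) := fun x => by
      have h1 := hone (G.dist o x)
      simp only [hφ, powLog]
      rw [hu, div_eq_mul_inv, mul_inv, rpow_neg (by linarith), rpow_neg (log_pos h1).le]
    refine ⟨fun x => by rw [hu']; exact mul_pos hδpos (hφpos _), fun x => ?_⟩
    have hF0 : ∀ y, ¬ G.Adj x y → μ x y * (u y - u x) = 0 := fun y hy => by
      rw [hμ0 x y hy, zero_mul]
    have hFchild : ∀ y ∈ G.children o x, μ x y * (u y - u x) =
        w (G.dist o x) / ((N : ℝ) - 1) ^ G.dist o x *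
          (δ * φ (G.dist o x + 1) - δ * φ (G.dist o x)) := fun y hy => by
      rw [hμchild x y hy, hu', hu', hy.2]
    have huσ : u x ^ σ = δ * δ₀ * φ (G.dist o x) ^ σ := by
      rw [hu', mul_rpow hδpos.le (hφpos _).le, hδσ]
    rw [huσ]
    rcases hx : G.dist o x with _ | k
    · obtain rfl := hconn.dist_eq_zero_iff.1 hx
      rw [hm0, G.finsum_root hN hdeg hF0 hFchild, hx, pow_zero, div_one, ← mul_assoc,
        mul_div_cancel_left₀ _ (mul_pos (by linarith) (hwpos 0)).ne']
      have h : δ₀ * φ 0 ^ σ ≤ φ 0 - φ 1 := (le_div_iff₀ hφσ).1 (min_le_right _ _)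
      have := mul_le_mul_of_nonneg_left h hδpos.le
      linarith
    · have hW : 0 < w (k + 1) + w k := add_pos (hwpos _) (hwpos _)
      have hnum : ∑ᶠ y, μ x y * (u y - u x) =
          -(δ * (w (k + 1) * (φ (k + 1) - φ (k + 2)) - w k * (φ k - φ (k + 1)))) /
            ((N : ℝ) - 1) ^ k := by
        rw [hG.finsum_of_parent hN hdeg (hne x k hx) hF0 hFchild
          (β := w k / ((N : ℝ) - 1) ^ k * (δ * φ k - δ * φ (k + 1)))
          (fun y h hy => by
            have hyk : G.dist o y = k := by omega
            rw [hμparent x y k h hyk hx, hu', hu', hyk, hx]), hx, pow_succ]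
        field_simp
        ring
      rw [hnum, hm1 x k hx, div_div_div_cancel_right₀ (by positivity), neg_div]
      have h : δ * δ₀ * φ (k + 1) ^ σ ≤
          δ * (w (k + 1) * (φ (k + 1) - φ (k + 2)) - w k * (φ k - φ (k + 1))) /
            (w (k + 1) + w k) := by
        rw [le_div_iff₀ hW, mul_assoc, mul_assoc]
        refine mul_le_mul_of_nonneg_left (le_trans ?_ (hflux k)) hδpos.le
        have := rpow_nonneg (hφpos (k + 1)).le σ
        rw [← mul_assoc]
        gcongr
        exact min_le_left _ _
      linarith
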